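/- Suppose the optimal objective value f* of the primal LP is finite, and let ε, δ ≥ 0. If R_ε is positive and finite, then min{ε, δ} ≤ R_ε · r_δ. -/

import Mathlib

open Metric Set Filter Topology
open scoped RealInnerProductSpace Classical

lemma eq_zero_of_forall_le_add_mul {u A B : ℝ} (h : ∀ k : ℝ, u ≤ A + k * B) : B = 0 := by
  by_contra hB
  have := h ((u - A - 1) / B)
  rw [div_mul_cancel₀ _ hB] at this
  linarith

lemma nonneg_of_forall_le_add_mul {u A B : ℝ} (h : ∀ k : ℝ, 0 ≤ k → u ≤ A + k * B) :
    0 ≤ B := by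
  by_contra! hB
  have h0 := h 0 le_rfl
  have := h ((u - A - 1) / B) (div_nonneg_of_nonpos (by linarith) hB.le)
  rw [div_mul_cancel₀ _ hB.ne] at this
  linarith

lemma le_of_forall_pos_sub_mul_le {u A B : ℝ} (h : ∀ η : ℝ, 0 < η → A - η * B ≤ u) :
    A ≤ u := by
  have ht : Tendsto (fun η : ℝ => A - η * B) (𝓝[>] 0) (𝓝 A) := by
    have : Tendsto (fun η : ℝ => A - η * B) (𝓝 0) (𝓝 (A - 0 * B)) :=
      Continuous.tendsto (by fun_prop) 0
    simpa using this.mono_left nhdsWithin_le_nhds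
  exact le_of_tendsto ht (eventually_mem_nhdsWithin.mono fun η hη => h η hη)

/-- A theorem of the alternative: if no point of the affine subspace `V` has all coordinates above
`r` and objective value below `a`, then nonnegative multipliers certify this. -/
lemma exists_multipliers_of_forall_not {n : ℕ} (V : AffineSubspace ℝ (EuclideanSpace ℝ (Fin n)))
    (c q : EuclideanSpace ℝ (Fin n)) (hq : q ∈ V) (hcq : ⟪c, q⟫ = 0) (r a : ℝ)
    (h : ∀ x ∈ V, (∀ i, r < x i) → a ≤ ⟪c, x⟫) :
    ∃ (y : EuclideanSpace ℝ (Fin n)) (l : ℝ), (∀ i, 0 ≤ y i) ∧ 0 ≤ l ∧ (l = 0 → y ≠ 0) ∧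
      y - l • c ∈ V.directionᗮ ∧ ⟪q, y⟫ + l * a ≤ r * ∑ i, y i := by
  let D : Set (EuclideanSpace ℝ (Fin n) × ℝ) := {p | (∀ i, r < p.1 i) ∧ p.2 < a}
  let T : Set (EuclideanSpace ℝ (Fin n) × ℝ) :=
    (fun x => (x, ⟪c, x⟫)) '' V
  have hDo : IsOpen D := by
    refine IsOpen.inter ?_ (isOpen_lt continuous_snd continuous_const)
    have : {p : EuclideanSpace ℝ (Fin n) × ℝ | ∀ i, r < p.1 i} =
        ⋂ i, {p : EuclideanSpace ℝ (Fin n) × ℝ | r < p.1 i} := by ext; simp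
    change IsOpen {p : EuclideanSpace ℝ (Fin n) × ℝ | ∀ i, r < p.1 i}
    rw [this]
    exact isOpen_iInter_of_finite fun i => isOpen_lt (by fun_prop) (by fun_prop)
  have hDc : Convex ℝ D := by
    rintro ⟨z, w⟩ ⟨hz, hw⟩ ⟨z', w'⟩ ⟨hz', hw'⟩ s t hs ht hst
    refine ⟨fun i => ?_, ?_⟩
    · exact (convex_Ioi r) (hz i) (hz' i) hs ht hst
    · exact (convex_Iio a) hw hw' hs ht hst
  have hTc : Convex ℝ T := by
    have : IsLinearMap ℝ (fun x : EuclideanSpace ℝ (Fin n) => (x, ⟪c, x⟫)) :=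
      ⟨fun x y => by simp [inner_add_right], fun k x => by simp [inner_smul_right]⟩
    exact V.convex.is_linear_image this
  have hdisj : Disjoint D T := by
    rw [Set.disjoint_left]
    rintro _ ⟨h1, h2⟩ ⟨x, hx, rfl⟩
    exact absurd (h x hx h1) (not_le.2 h2)
  obtain ⟨f, u, hfD, hfT⟩ := geometric_hahn_banach_open hDc hDo hTc hdisj
  obtain ⟨y, hy⟩ : ∃ y : EuclideanSpace ℝ (Fin n), ∀ z, f (z, 0) = -⟪y, z⟫ := by
    refine ⟨-(InnerProductSpace.toDual ℝ _).symm (f.comp (ContinuousLinearMap.inl ℝ _ ℝ)), ?_⟩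
    intro z
    simp
  obtain ⟨l, hl⟩ : ∃ l, l = f (0, 1) := ⟨_, rfl⟩
  have hf : ∀ z w, f (z, w) = -⟪y, z⟫ + l * w := by
    intro z w
    have : ((z, w) : EuclideanSpace ℝ (Fin n) × ℝ) = (z, 0) + w • (0, 1) := by simp
    rw [this, map_add, map_smul, hy, ← hl, smul_eq_mul, mul_comm]
  have hD : ∀ z : EuclideanSpace ℝ (Fin n), ∀ w, (∀ i, r < z i) → w < a → -⟪y, z⟫ + l * w < u := by
    intro z w hz hw
    rw [← hf]
    exact hfD _ ⟨hz, hw⟩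
  have hT : ∀ x ∈ V, u ≤ -⟪y, x⟫ + l * ⟪c, x⟫ := by
    intro x hx
    rw [← hf]
    exact hfT _ ⟨x, hx, rfl⟩
  have hconst : ∀ t : ℝ, ⟪y, WithLp.toLp 2 (fun _ : Fin n => t)⟫ = t * ∑ i, y i := by
    intro t
    simp [PiLp.inner_apply, Finset.mul_sum]
  refine ⟨y, l, fun i => ?_, ?_, ?_, ?_, ?_⟩
  · refine nonneg_of_forall_le_add_mul
      (u := -u) (A := (r + 1) * ∑ i, y i - l * (a - 1)) fun k hk => ?_
    have := hD (WithLp.toLp 2 (fun _ : Fin n => r + 1) + EuclideanSpace.single i k) (a - 1)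
      (fun j => by
        have : 0 ≤ (EuclideanSpace.single i k : EuclideanSpace ℝ (Fin n)) j := by
          by_cases hj : j = i <;> simp [hj, hk]
        simp only [PiLp.add_apply]
        linarith) (by linarith)
    rw [inner_add_right, hconst, EuclideanSpace.inner_single_right] at this
    simp at this
    linarith
  · refine nonneg_of_forall_le_add_mul
      (u := -u) (A := (r + 1) * ∑ i, y i - l * (a - 1)) fun k hk => ?_
    have := hD (WithLp.toLp 2 (fun _ : Fin n => r + 1)) (a - 1 - k)
      (fun j => by simp) (by linarith)
    rw [hconst] at this
    linarith
  · rintro rfl rfl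
    have h1 := hD (WithLp.toLp 2 (fun _ : Fin n => r + 1)) (a - 1) (fun j => by simp) (by linarith)
    have h2 := hT q hq
    simp at h1 h2
    linarith
  · rw [Submodule.mem_orthogonal']
    intro v hv
    have : -⟪y - l • c, v⟫ = 0 := by
      refine eq_zero_of_forall_le_add_mul (u := u) (A := -⟪y, q⟫ + l * ⟪c, q⟫) fun k => ?_
      have := hT (k • v +ᵥ q) (AffineSubspace.vadd_mem_of_mem_direction
        (V.direction.smul_mem k hv) hq)
      simp only [vadd_eq_add, inner_add_right, inner_smul_right, inner_sub_left,
        real_inner_smul_left] at this ⊢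
      linarith
    linarith
  · have h1 := hT q hq
    have h2 : -(r * ∑ i, y i) + l * a ≤ u := by
      refine le_of_forall_pos_sub_mul_le (B := ∑ i, y i + l) fun η hη => ?_
      have := hD (WithLp.toLp 2 (fun _ : Fin n => r + η)) (a - η) (fun j => by simp [hη])
        (by linarith)
      rw [hconst] at this
      linarith
    rw [hcq, real_inner_comm] at h1
    linarith

/-- The point of minimum norm of an affine subspace is orthogonal to its direction. -/
lemma mem_direction_orthogonal_of_norm_min {E : Type*} [NormedAddCommGroup E]
    [InnerProductSpace ℝ E] (V : AffineSubspace ℝ E) {q : E} (hq : q ∈ V)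
    (hmin : ∀ v ∈ V, ‖q‖ ≤ ‖v‖) : q ∈ V.directionᗮ := by
  rw [Submodule.mem_orthogonal]
  intro v hv
  by_contra hne
  have hv0 : 0 < ‖v‖ ^ 2 := by
    have : v ≠ 0 := by rintro rfl; simp at hne
    positivity
  have h := hmin ((-(⟪v, q⟫ / ‖v‖ ^ 2)) • v +ᵥ q)
    (AffineSubspace.vadd_mem_of_mem_direction (V.direction.smul_mem _ hv) hq)
  have h2 := pow_le_pow_left₀ (norm_nonneg _) h 2
  rw [vadd_eq_add, norm_add_sq_real, norm_smul, real_inner_smul_left, mul_pow, Real.norm_eq_abs,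
    sq_abs] at h2
  have h3 : (-(⟪v, q⟫ / ‖v‖ ^ 2)) ^ 2 * ‖v‖ ^ 2 + 2 * (-(⟪v, q⟫ / ‖v‖ ^ 2) * ⟪v, q⟫)
      = -(⟪v, q⟫ ^ 2 / ‖v‖ ^ 2) := by
    field_simp
    ring
  have h4 : 0 < ⟪v, q⟫ ^ 2 / ‖v‖ ^ 2 := by positivity
  linarith

/-- Theorem 2.1 of Freund, lower bound: if the optimal value `f*` of the
primal LP is finite and `R_ε` is positive (and finite), then `min{ε, δ} ≤ R_ε · r_δ`. -/
theorem min_le_Reps_mul_rdelta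
    (n : ℕ) (hn : 0 < n)
    (Vp : AffineSubspace ℝ (EuclideanSpace ℝ (Fin n)))
    (c : EuclideanSpace ℝ (Fin n)) (hcdir : c ∈ Vp.direction)
    (Fp : Set (EuclideanSpace ℝ (Fin n)))
    (hFp : Fp = {x | x ∈ Vp ∧ ∀ i, 0 ≤ x i})
    (fstar : ℝ)
    (hfstar : IsGLB ((fun x => ⟪c, x⟫) '' Fp) fstar)
    (Vd : Set (EuclideanSpace ℝ (Fin n)))
    (hVd : Vd = {s | s - c ∈ Vp.directionᗮ})
    (Fd : Set (EuclideanSpace ℝ (Fin n)))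
    (hFd : Fd = {s | s ∈ Vd ∧ ∀ i, 0 ≤ s i})
    (q : EuclideanSpace ℝ (Fin n)) (hqVp : q ∈ Vp)
    (hqmin : ∀ v ∈ (Vp : Set (EuclideanSpace ℝ (Fin n))), ‖q‖ ≤ ‖v‖)
    (ε δ : ℝ) (hε : 0 ≤ ε) (hδ : 0 ≤ δ)
    (rδ : ℝ)
    (hrδ : IsGreatest {t | ∃ x ∈ Fp, ⟪c, x⟫ ≤ fstar + δ ∧ t = ⨅ i, x i} rδ)
    (Rε : ℝ)
    (hRε : IsGreatest {t | ∃ s ∈ Fd, fstar - ε ≤ -⟪q, s⟫ ∧ t = ∑ i, |s i|} Rε)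
    (hRpos : 0 < Rε) :
    min ε δ ≤ Rε * rδ := by
  have hqorth := mem_direction_orthogonal_of_norm_min Vp hqVp hqmin
  have hcq : ⟪c, q⟫ = 0 := (Submodule.mem_orthogonal _ _).1 hqorth c hcdir
  subst hFp hVd hFd
  have : Nonempty (Fin n) := ⟨⟨0, hn⟩⟩
  have hfle : ∀ x ∈ Vp, (∀ i, 0 ≤ x i) → fstar ≤ ⟪c, x⟫ := fun x hx h0 =>
    hfstar.1 ⟨x, ⟨hx, h0⟩, rfl⟩
  have hr0 : 0 ≤ rδ := by
    obtain ⟨x, hx, -, rfl⟩ := hrδ.1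
    exact le_ciInf hx.2
  have hRub : ∀ s : EuclideanSpace ℝ (Fin n), s - c ∈ Vp.directionᗮ → (∀ i, 0 ≤ s i) →
      fstar + ⟪q, s⟫ ≤ ε → ∑ i, s i ≤ Rε := by
    intro s hs h0 hgap
    refine hRε.2 ⟨s, ⟨hs, h0⟩, by linarith, ?_⟩
    exact Finset.sum_congr rfl fun i _ => (abs_of_nonneg (h0 i)).symm
  obtain ⟨s₀, ⟨hs₀, hs₀0⟩, hs₀gap, -⟩ := hRε.1
  -- a dual recession direction that does not increase the gap contradicts the finiteness of `Rε`
  have hrec : ∀ y : EuclideanSpace ℝ (Fin n), y ∈ Vp.directionᗮ → (∀ i, 0 ≤ y i) →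
      ⟪q, y⟫ ≤ 0 → y = 0 := by
    intro y hy hy0 hqy
    have hle : 0 ≤ -∑ i, y i := by
      refine nonneg_of_forall_le_add_mul (u := -Rε) (A := -∑ i, s₀ i) fun k hk => ?_
      have := hRub (s₀ + k • y) ?_ (fun i => ?_) ?_
      · simp [Finset.sum_add_distrib, ← Finset.mul_sum] at this
        linarith
      · rw [add_sub_right_comm]
        exact Submodule.add_mem _ hs₀ (Submodule.smul_mem _ _ hy)
      · simpa using add_nonneg (hs₀0 i) (mul_nonneg hk (hy0 i))
      · rw [inner_add_right, inner_smul_right]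
        nlinarith
    have hsum : ∑ i, y i = 0 := le_antisymm (by linarith) (Finset.sum_nonneg fun i _ => hy0 i)
    ext i
    simpa using (Finset.sum_eq_zero_iff_of_nonneg fun i _ => hy0 i).1 hsum i (Finset.mem_univ i)
  obtain ⟨s, hs, hs0, hsgap⟩ : ∃ s : EuclideanSpace ℝ (Fin n), s - c ∈ Vp.directionᗮ ∧
      (∀ i, 0 ≤ s i) ∧ fstar + ⟪q, s⟫ ≤ 0 := by
    obtain ⟨y, l, hy0, hl0, hne, hyl, hyq⟩ := exists_multipliers_of_forall_not Vp c q hqVp hcq 0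
      fstar fun x hx h => hfle x hx fun i => (h i).le
    rcases hl0.eq_or_lt with rfl | hl
    · exact absurd (hrec y (by simpa using hyl) hy0 (by simpa using hyq)) (hne rfl)
    · refine ⟨l⁻¹ • y, ?_, fun i => ?_, ?_⟩
      · have := Submodule.smul_mem _ l⁻¹ hyl
        rwa [smul_sub, smul_smul, inv_mul_cancel₀ hl.ne', one_smul] at this
      · simpa using mul_nonneg (inv_nonneg.2 hl0) (hy0 i)
      · rw [inner_smul_right]
        have : fstar + l⁻¹ * ⟪q, y⟫ = l⁻¹ * (⟪q, y⟫ + l * fstar) := by field_simp; ring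
        rw [this]
        exact mul_nonpos_of_nonneg_of_nonpos (inv_nonneg.2 hl0) (by simpa using hyq)
  obtain ⟨y, l, hy0, hl0, hne, hyl, hyq⟩ := exists_multipliers_of_forall_not Vp c q hqVp hcq rδ
    (fstar + δ) fun x hx h => by
      by_contra! hlt
      have hle := hrδ.2 ⟨x, ⟨hx, fun i => hr0.trans (h i).le⟩, hlt.le, rfl⟩
      obtain ⟨i, hi⟩ := exists_eq_ciInf_of_finite (f := fun i => x i)
      exact absurd (h i) (not_lt.2 (hi.trans_le hle))
  have hG : 0 ≤ ⟪q, y⟫ + l * fstar := by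
    obtain ⟨x₁, ⟨hx₁, hx₁0⟩, -⟩ := hrδ.1
    have hval : ∀ x ∈ Vp, (∀ i, 0 ≤ x i) → 0 ≤ ⟪q, y⟫ + l * ⟪c, x⟫ := by
      intro x hx hx0
      have h1 : ⟪y - l • c, x - q⟫ = 0 :=
        (Submodule.mem_orthogonal' _ _).1 hyl _ (AffineSubspace.vsub_mem_direction hx hqVp)
      have h2 : 0 ≤ ⟪y, x⟫ := by
        rw [PiLp.inner_apply]
        exact Finset.sum_nonneg fun i _ => by simpa using mul_nonneg (hx0 i) (hy0 i)
      simp only [inner_sub_left, inner_sub_right, real_inner_smul_left, hcq] at h1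
      rw [real_inner_comm]
      linarith
    rcases hl0.eq_or_lt with rfl | hl
    · simpa using hval x₁ hx₁ hx₁0
    · have : -⟪q, y⟫ / l ≤ fstar := hfstar.2 (by
        rintro _ ⟨x, ⟨hx, hx0⟩, rfl⟩
        rw [div_le_iff₀ hl]
        linarith [hval x hx hx0])
      rw [div_le_iff₀ hl] at this
      linarith
  have hkey : (⟪q, y⟫ + l * fstar) + l * δ ≤ rδ * ∑ i, y i := by linarith
  generalize hGdef : ⟪q, y⟫ + l * fstar = G at hG hkey
  rcases le_or_gt G (l * ε) with hGl | hGl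
  · -- `l⁻¹ • y` is itself an `ε`-optimal dual solution
    refine (min_le_right _ _).trans ?_
    rcases hl0.eq_or_lt with rfl | hl
    · exact absurd (hrec y (by simpa using hyl) hy0 (by linarith)) (hne rfl)
    · have hR := hRub (l⁻¹ • y) ?_ (fun i => ?_) ?_
      · simp only [PiLp.smul_apply, smul_eq_mul, ← Finset.mul_sum] at hR
        rw [inv_mul_le_iff₀ hl] at hR
        have := mul_le_mul_of_nonneg_left hR hr0
        refine le_of_mul_le_mul_left (a := l) ?_ hl
        linarith
      · have := Submodule.smul_mem _ l⁻¹ hyl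
        rwa [smul_sub, smul_smul, inv_mul_cancel₀ hl.ne', one_smul] at this
      · simpa using mul_nonneg (inv_nonneg.2 hl0) (hy0 i)
      · rw [inner_smul_right]
        have : fstar + l⁻¹ * ⟪q, y⟫ = l⁻¹ * G := by rw [← hGdef]; field_simp; ring
        rw [this, inv_mul_le_iff₀ hl]
        exact hGl
  · -- move from the dual optimum `s` towards `y` until the gap reaches `ε`
    refine (min_le_left _ _).trans ?_
    have hGpos : 0 < G := (mul_nonneg hl0 hε).trans_lt hGl
    have hθ : 0 ≤ 1 - l * (ε / G) := by
      rw [sub_nonneg, ← mul_div_assoc, div_le_one hGpos]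
      exact hGl.le
    have hεG : 0 ≤ ε / G := div_nonneg hε hG
    have hR := hRub ((1 - l * (ε / G)) • s + (ε / G) • y) ?_ (fun i => ?_) ?_
    · simp only [PiLp.add_apply, PiLp.smul_apply, smul_eq_mul, Finset.sum_add_distrib,
        ← Finset.mul_sum] at hR
      have h1 : 0 ≤ (1 - l * (ε / G)) * ∑ i, s i :=
        mul_nonneg hθ (Finset.sum_nonneg fun i _ => hs0 i)
      have h2 : ε / G * G ≤ ε / G * (rδ * ∑ i, y i) :=
        mul_le_mul_of_nonneg_left (by nlinarith) hεG
      rw [div_mul_cancel₀ _ hGpos.ne'] at h2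
      have h3 : (ε / G * ∑ i, y i) * rδ ≤ Rε * rδ :=
        mul_le_mul_of_nonneg_right (by linarith) hr0
      linarith
    · have : (1 - l * (ε / G)) • s + (ε / G) • y - c
          = (1 - l * (ε / G)) • (s - c) + (ε / G) • (y - l • c) := by module
      rw [this]
      exact Submodule.add_mem _ (Submodule.smul_mem _ _ hs) (Submodule.smul_mem _ _ hyl)
    · simpa using add_nonneg (mul_nonneg hθ (hs0 i)) (mul_nonneg hεG (hy0 i))
    · rw [inner_add_right, inner_smul_right, inner_smul_right]
      have h1 : fstar + ((1 - l * (ε / G)) * ⟪q, s⟫ + ε / G * ⟪q, y⟫)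
          = (1 - l * (ε / G)) * (fstar + ⟪q, s⟫) + ε / G * G := by
        linear_combination ε / G * hGdef
      rw [h1, div_mul_cancel₀ _ hGpos.ne']
      linarith [mul_nonpos_of_nonneg_of_nonpos hθ hsgap]
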